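/- Let M be a von Neumann algebra and φ ∈ M_* a faithful normal state such that the centralizer M_φ is a factor. Then for all nonzero ψ₁, ψ₂ ∈ (M_*)⁺, if ψ₁ ∼_M φ and ψ₂ ∼_M φ, then ψ₁ ∼_M ψ₂. -/

import Mathlib

/-!
Common framework for formalizing Houdayer–Isono,
"Pointwise inner automorphisms of almost periodic factors".

Von Neumann algebras are modeled concretely, following Mathlib, as
`VonNeumannAlgebra H` for a complex Hilbert space `H`.  Notions that are not
available in Mathlib (normal states and weights, modular automorphism groups,
Connes cocycles, tensor/free product decompositions, …) are modeled by
explicit predicates/structures whose fields record their standard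
characterizing properties (e.g. the modular group of a state is characterized
as the pointwise SOT-continuous one-parameter automorphism group satisfying
the KMS condition).
-/

open scoped ComplexOrder ENNReal

namespace HSC

variable {H : Type} [NormedAddCommGroup H] [InnerProductSpace ℂ H] [CompleteSpace H]

/-- The bounded operators on the Hilbert space `H`. -/
abbrev Op (H : Type) [NormedAddCommGroup H] [InnerProductSpace ℂ H] [CompleteSpace H] : Type :=
  H →L[ℂ] H

/-- Positivity of a bounded operator on a Hilbert space. -/
def IsPos (x : Op H) : Prop := ContinuousLinearMap.IsPositive x

/-- `p` is an (orthogonal) projection belonging to the set `A` of operators. -/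
def IsProjIn (A : Set (Op H)) (p : Op H) : Prop := p ∈ A ∧ star p = p ∧ p * p = p

/-- `u` is a unitary belonging to the set `A` of operators. -/
def IsUnitaryIn (A : Set (Op H)) (u : Op H) : Prop := u ∈ A ∧ star u * u = 1 ∧ u * star u = 1

/-- `v` is a partial isometry. -/
def IsPartialIsom (v : Op H) : Prop := star v * v * (star v * v) = star v * v

/-- `φ` is a positive linear functional on `M` (recorded as a function on all of `B(H)`;
only its values on `M` matter). -/
structure IsPLF (M : VonNeumannAlgebra H) (φ : Op H → ℂ) : Prop where
  map_add : ∀ x ∈ M, ∀ y ∈ M, φ (x + y) = φ x + φ y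
  map_smul : ∀ (c : ℂ), ∀ x ∈ M, φ (c • x) = c * φ x
  pos : ∀ x ∈ M, 0 ≤ φ (star x * x)

/-- `φ` is a *normal* positive linear functional on `M`: a positive linear functional which is
completely additive on orthogonal families of projections (sums taken in the strong topology). -/
structure IsNormalPLF (M : VonNeumannAlgebra H) (φ : Op H → ℂ) extends IsPLF M φ : Prop where
  normal : ∀ (ι : Type) (p : ι → Op H) (q : Op H),
    (∀ i, IsProjIn (M : Set (Op H)) (p i)) → IsProjIn (M : Set (Op H)) q →
    (Pairwise fun i j => p i * p j = 0) →
    (∀ ξ : H, HasSum (fun i => p i ξ) (q ξ)) →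
    HasSum (fun i => φ (p i)) (φ q)

/-- `φ` is a normal state on `M`. -/
def IsNormalState (M : VonNeumannAlgebra H) (φ : Op H → ℂ) : Prop :=
  IsNormalPLF M φ ∧ φ 1 = 1

/-- Faithfulness of a positive linear functional on `M`. -/
def IsFaithfulOn (M : VonNeumannAlgebra H) (φ : Op H → ℂ) : Prop :=
  ∀ x ∈ M, φ (star x * x) = 0 → x = 0

/-- `φ` is a faithful normal state on `M`. -/
def IsFNState (M : VonNeumannAlgebra H) (φ : Op H → ℂ) : Prop :=
  IsNormalState M φ ∧ IsFaithfulOn M φ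

/-- `p` is the support projection `s(φ)` of `φ` in `M`: the smallest projection of `M`
compressing to which does not change `φ`. -/
def IsSupportProjOf (M : VonNeumannAlgebra H) (φ : Op H → ℂ) (p : Op H) : Prop :=
  IsProjIn (M : Set (Op H)) p ∧ (∀ x ∈ M, φ (p * x * p) = φ x) ∧
    ∀ q, IsProjIn (M : Set (Op H)) q → (∀ x ∈ M, φ (q * x * q) = φ x) → p * q = p

/-- `ψ ∼_M φ` : the normal positive functionals `ψ` and `φ` are intertwined in `M`,
i.e. there are a nonzero partial isometry `v ∈ s(ψ) M s(φ)` and `l > 0` with `ψ v = l v φ`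
(with the bimodule conventions `(ψ v)(x) = ψ(vx)`, `(v φ)(x) = φ(xv)`). -/
def Intertwined (M : VonNeumannAlgebra H) (ψ φ : Op H → ℂ) : Prop :=
  ∃ (v q p : Op H) (l : ℝ), 0 < l ∧ v ∈ M ∧ IsPartialIsom v ∧ v ≠ 0 ∧
    IsSupportProjOf M ψ q ∧ IsSupportProjOf M φ p ∧ q * v = v ∧ v * p = v ∧
    ∀ x ∈ M, ψ (v * x) = (l : ℂ) * φ (x * v)

/-- An automorphism of the von Neumann algebra `M` (automatically normal). -/
structure VNAut (M : VonNeumannAlgebra H) where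
  toFun : Op H → Op H
  invFun : Op H → Op H
  mem' : ∀ x ∈ M, toFun x ∈ M
  inv_mem' : ∀ x ∈ M, invFun x ∈ M
  left_inv' : ∀ x ∈ M, invFun (toFun x) = x
  right_inv' : ∀ x ∈ M, toFun (invFun x) = x
  map_add' : ∀ x ∈ M, ∀ y ∈ M, toFun (x + y) = toFun x + toFun y
  map_smul' : ∀ (c : ℂ), ∀ x ∈ M, toFun (c • x) = c • toFun x
  map_mul' : ∀ x ∈ M, ∀ y ∈ M, toFun (x * y) = toFun x * toFun y
  map_star' : ∀ x ∈ M, toFun (star x) = star (toFun x)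

/-- `Θ` is pointwise inner: for every normal state `ψ` there is a unitary `u ∈ M` with
`Θ(ψ) = u ψ u*`, i.e. `ψ(Θ⁻¹(x)) = ψ(u* x u)` for all `x ∈ M`. -/
def PointwiseInner {M : VonNeumannAlgebra H} (Θ : VNAut M) : Prop :=
  ∀ ψ : Op H → ℂ, IsNormalState M ψ →
    ∃ u, IsUnitaryIn (M : Set (Op H)) u ∧
      ∀ x ∈ M, ψ (Θ.invFun x) = ψ (star u * x * u)

/-- The closed horizontal strip `0 ≤ Im z ≤ 1`. -/
def strip : Set ℂ := {z | 0 ≤ z.im ∧ z.im ≤ 1}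

/-- The open horizontal strip `0 < Im z < 1`. -/
def stripo : Set ℂ := {z | 0 < z.im ∧ z.im < 1}

/-- `σ` is the modular automorphism group `σ^φ` of the (faithful normal) state `φ` on `M`:
a pointwise SOT-continuous one-parameter group of ∗-automorphisms of `M` preserving `φ` and
satisfying the KMS condition at inverse temperature 1. -/
structure IsModularFlow (M : VonNeumannAlgebra H) (φ : Op H → ℂ) (σ : ℝ → Op H → Op H) :
    Prop where
  mem' : ∀ (t : ℝ), ∀ x ∈ M, σ t x ∈ M
  zero' : ∀ x ∈ M, σ 0 x = x
  add' : ∀ (s t : ℝ), ∀ x ∈ M, σ (s + t) x = σ s (σ t x)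
  map_add' : ∀ (t : ℝ), ∀ x ∈ M, ∀ y ∈ M, σ t (x + y) = σ t x + σ t y
  map_smul' : ∀ (t : ℝ) (c : ℂ), ∀ x ∈ M, σ t (c • x) = c • σ t x
  map_mul' : ∀ (t : ℝ), ∀ x ∈ M, ∀ y ∈ M, σ t (x * y) = σ t x * σ t y
  map_star' : ∀ (t : ℝ), ∀ x ∈ M, σ t (star x) = star (σ t x)
  invariant' : ∀ (t : ℝ), ∀ x ∈ M, φ (σ t x) = φ x
  continuous' : ∀ x ∈ M, ∀ ξ : H, Continuous fun t : ℝ => σ t x ξ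
  kms' : ∀ x ∈ M, ∀ y ∈ M, ∃ F : ℂ → ℂ, ContinuousOn F strip ∧
    DifferentiableOn ℂ F stripo ∧ (∃ C : ℝ, ∀ z ∈ strip, ‖F z‖ ≤ C) ∧
    (∀ t : ℝ, F (t : ℂ) = φ (σ t x * y)) ∧
    (∀ t : ℝ, F ((t : ℂ) + Complex.I) = φ (y * σ t x))

/-- `l ^ (i t)` for `l > 0`. -/
noncomputable def cpowit (l t : ℝ) : ℂ := Complex.exp (Complex.I * t * Real.log l)

/-- `x ∈ M` is an `l`-eigenvector of the modular flow `σ`, i.e. `σ_t(x) = l^{it} x`. -/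
def IsEigenvector (M : VonNeumannAlgebra H) (σ : ℝ → Op H → Op H) (l : ℝ) (x : Op H) :
    Prop :=
  x ∈ M ∧ ∀ t : ℝ, σ t x = cpowit l t • x

/-- The point spectrum `σ_p(Δ_φ)` of the modular operator, described via eigenvectors in `M`. -/
def pointSpectrum (M : VonNeumannAlgebra H) (σ : ℝ → Op H → Op H) : Set ℝ :=
  {l | 0 < l ∧ ∃ x, x ≠ 0 ∧ IsEigenvector M σ l x}

/-- The linear span of the eigenvectors of the modular flow. -/
def eigenSpan (M : VonNeumannAlgebra H) (σ : ℝ → Op H → Op H) : Submodule ℂ (Op H) :=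
  Submodule.span ℂ {x | ∃ l : ℝ, 0 < l ∧ IsEigenvector M σ l x}

/-- Almost periodicity of `φ` (via its modular flow `σ`): the linear span of the
eigenvectors is ∗-strongly dense in `M`. -/
def IsAlmostPeriodicFlow (M : VonNeumannAlgebra H) (σ : ℝ → Op H → Op H) : Prop :=
  ∀ x ∈ M, ∀ ε : ℝ, 0 < ε → ∀ Ξ : Finset H, ∃ y ∈ eigenSpan M σ,
    ∀ ξ ∈ Ξ, ‖(x - y) ξ‖ < ε ∧ ‖(star x - star y) ξ‖ < ε

/-- The centralizer `M_φ` of a state `φ` on `M`. -/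
def stateCentralizer (M : VonNeumannAlgebra H) (φ : Op H → ℂ) : Set (Op H) :=
  {x | x ∈ M ∧ ∀ y ∈ M, φ (x * y) = φ (y * x)}

/-- The fixed-point algebra of the flow `σ` on `M` (`= M_φ` for the modular flow of a weight). -/
def flowFixed (M : VonNeumannAlgebra H) (σ : ℝ → Op H → Op H) : Set (Op H) :=
  {x | x ∈ M ∧ ∀ t : ℝ, σ t x = x}

/-- A set of operators (e.g. a von Neumann subalgebra) has trivial center. -/
def IsFactorSet (A : Set (Op H)) : Prop :=
  ∀ x ∈ A, (∀ y ∈ A, x * y = y * x) → ∃ c : ℂ, x = c • (1 : Op H)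

/-- `M` is a factor. -/
def IsFactor (M : VonNeumannAlgebra H) : Prop := IsFactorSet (M : Set (Op H))

/-- Murray–von Neumann equivalence of projections, relative to the set `A`. -/
def MvNEquivIn (A : Set (Op H)) (p q : Op H) : Prop :=
  ∃ v ∈ A, star v * v = p ∧ v * star v = q

/-- `p` is a finite projection relative to `A`: no proper subprojection of `p`
is Murray–von Neumann equivalent (in `A`) to `p`. -/
def IsFiniteProjIn (A : Set (Op H)) (p : Op H) : Prop :=
  ∀ q, IsProjIn A q → q * p = q → MvNEquivIn A p q → q = p

/-- `p` is a minimal projection relative to `A`. -/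
def IsMinimalProjIn (A : Set (Op H)) (p : Op H) : Prop :=
  IsProjIn A p ∧ p ≠ 0 ∧ ∀ q, IsProjIn A q → q * p = q → q = 0 ∨ q = p

/-- `M` is a type III factor: a factor with no nonzero finite projection. -/
def IsTypeIIIFactor (M : VonNeumannAlgebra H) : Prop :=
  IsFactor M ∧
    ∀ p, IsProjIn (M : Set (Op H)) p → p ≠ 0 → ¬ IsFiniteProjIn (M : Set (Op H)) p

/-- The ∗-closed set `A` (e.g. a corner or a subalgebra) is a type II₁ factor:
trivial center, `1` finite, and no minimal projections. -/
def IsTypeII1FactorSet (A : Set (Op H)) : Prop :=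
  IsFactorSet A ∧ (1 : Op H) ∈ A ∧ IsFiniteProjIn A 1 ∧ ∀ p, ¬ IsMinimalProjIn A p

/-- `A` is a type I_∞ factor (model for `B(ℓ²)`): a factor with a minimal projection
whose unit is not finite. -/
def IsTypeIInfFactorSet (A : Set (Op H)) : Prop :=
  IsFactorSet A ∧ (1 : Op H) ∈ A ∧ (∃ p, IsMinimalProjIn A p) ∧ ¬ IsFiniteProjIn A 1

/-- `M` is a type III₁ factor.  By the Connes–Størmer transitivity theorem, among
type III factors with separable predual, type III₁ is characterized by the topological
transitivity of the unitary group action on faithful normal states. -/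
def IsTypeIII1Factor (M : VonNeumannAlgebra H) : Prop :=
  IsTypeIIIFactor M ∧
    ∀ φ ψ : Op H → ℂ, IsFNState M φ → IsFNState M ψ → ∀ ε : ℝ, 0 < ε →
      ∃ u, IsUnitaryIn (M : Set (Op H)) u ∧
        ∀ x ∈ M, ‖x‖ ≤ 1 → ‖φ (star u * x * u) - ψ x‖ < ε

/-- `M` is injective (= amenable, = hyperfinite by Connes' theorem):
there is a norm-one projection `B(H) → M`. -/
def IsInjectiveVNA (M : VonNeumannAlgebra H) : Prop :=
  ∃ E : Op H →ₗ[ℂ] Op H, (∀ x, E x ∈ M) ∧ (∀ x ∈ M, E x = x) ∧ ∀ x, ‖E x‖ ≤ ‖x‖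

/-- `M` is (a copy of) the Araki–Woods factor `R_∞`: the unique amenable (injective)
type III₁ factor with separable predual. -/
def IsArakiWoodsRInfty (M : VonNeumannAlgebra H) : Prop :=
  IsTypeIII1Factor M ∧ IsInjectiveVNA M

/-- Data of a faithful normal semifinite weight: its value `val` on positive elements
(in `[0,∞]`), together with a linear extension `cval` of its restriction to the
definition ideal `m_φ` (the values of `cval` outside `m_φ` are irrelevant). -/
structure WeightData (H : Type) [NormedAddCommGroup H] [InnerProductSpace ℂ H]
    [CompleteSpace H] where
  val : Op H → ℝ≥0∞
  cval : Op H → ℂ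

/-- `W` is a faithful normal semifinite weight on `M`. -/
structure IsFNSWeight (M : VonNeumannAlgebra H) (W : WeightData H) : Prop where
  map_add : ∀ x ∈ M, ∀ y ∈ M, IsPos x → IsPos y → W.val (x + y) = W.val x + W.val y
  map_smul : ∀ c : ℝ, 0 < c → ∀ x ∈ M, IsPos x →
    W.val ((c : ℂ) • x) = ENNReal.ofReal c * W.val x
  faithful : ∀ x ∈ M, IsPos x → W.val x = 0 → x = 0
  semifinite : ∀ x ∈ M, IsPos x → x ≠ 0 →
    ∃ y ∈ M, IsPos y ∧ y ≠ 0 ∧ IsPos (x - y) ∧ W.val y ≠ ⊤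
  normal : ∀ (ι : Type) (p : ι → Op H) (q : Op H),
    (∀ i, IsProjIn (M : Set (Op H)) (p i)) → IsProjIn (M : Set (Op H)) q →
    (Pairwise fun i j => p i * p j = 0) →
    (∀ ξ : H, HasSum (fun i => p i ξ) (q ξ)) →
    W.val q = ∑' i, W.val (p i)
  cval_add : ∀ x ∈ M, ∀ y ∈ M, W.cval (x + y) = W.cval x + W.cval y
  cval_smul : ∀ (c : ℂ), ∀ x ∈ M, W.cval (c • x) = c * W.cval x
  cval_compat : ∀ x ∈ M, IsPos x → W.val x ≠ ⊤ → W.cval x = ((W.val x).toReal : ℂ)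

/-- `σ` is the modular automorphism group `σ^φ` of the faithful normal semifinite
weight `W` on `M` (KMS condition required on the definition ideal). -/
structure IsModularFlowW (M : VonNeumannAlgebra H) (W : WeightData H)
    (σ : ℝ → Op H → Op H) : Prop where
  mem' : ∀ (t : ℝ), ∀ x ∈ M, σ t x ∈ M
  zero' : ∀ x ∈ M, σ 0 x = x
  add' : ∀ (s t : ℝ), ∀ x ∈ M, σ (s + t) x = σ s (σ t x)
  map_add' : ∀ (t : ℝ), ∀ x ∈ M, ∀ y ∈ M, σ t (x + y) = σ t x + σ t y
  map_smul' : ∀ (t : ℝ) (c : ℂ), ∀ x ∈ M, σ t (c • x) = c • σ t x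
  map_mul' : ∀ (t : ℝ), ∀ x ∈ M, ∀ y ∈ M, σ t (x * y) = σ t x * σ t y
  map_star' : ∀ (t : ℝ), ∀ x ∈ M, σ t (star x) = star (σ t x)
  invariant' : ∀ (t : ℝ), ∀ x ∈ M, IsPos x → W.val (σ t x) = W.val x
  continuous' : ∀ x ∈ M, ∀ ξ : H, Continuous fun t : ℝ => σ t x ξ
  kms' : ∀ x ∈ M, ∀ y ∈ M,
    W.val (star x * x) ≠ ⊤ → W.val (x * star x) ≠ ⊤ →
    W.val (star y * y) ≠ ⊤ → W.val (y * star y) ≠ ⊤ →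
    ∃ F : ℂ → ℂ, ContinuousOn F strip ∧ DifferentiableOn ℂ F stripo ∧
      (∃ C : ℝ, ∀ z ∈ strip, ‖F z‖ ≤ C) ∧
      (∀ t : ℝ, F (t : ℂ) = W.cval (σ t x * y)) ∧
      (∀ t : ℝ, F ((t : ℂ) + Complex.I) = W.cval (y * σ t x))

/-- The weight `W` is strictly semifinite: its restriction to the centralizer
(= fixed points of the modular flow `σ`) is semifinite. -/
def IsStrictlySemifiniteOn (M : VonNeumannAlgebra H) (W : WeightData H)
    (σ : ℝ → Op H → Op H) : Prop :=
  ∀ x ∈ flowFixed M σ, IsPos x → x ≠ 0 →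
    ∃ y ∈ flowFixed M σ, IsPos y ∧ y ≠ 0 ∧ IsPos (x - y) ∧ W.val y ≠ ⊤

/-- `h` is a positive element of the corner `pAp`, invertible in this corner. -/
def CornerPosInvertibleIn (A : Set (Op H)) (p h : Op H) : Prop :=
  h ∈ A ∧ IsPos h ∧ p * h = h ∧ h * p = h ∧
    ∃ h' ∈ A, p * h' = h' ∧ h' * p = h' ∧ h * h' = p ∧ h' * h = p

/-- `Θ` is locally pointwise inner for the strictly semifinite weight `W` (with modular flow
`σ`): `Θ(φ) = φ`, and for every nonzero projection `p ∈ M_φ` with `φ(p) < ∞` and every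
positive invertible `h ∈ pM_φp` one has `Θ(φ_h) ∼_M φ_h`, where `φ_h = φ(h^{1/2}·h^{1/2})`
(below `k = h^{1/2}` is the positive square root of `h` in `M_φ`). -/
def LocallyPointwiseInnerW {M : VonNeumannAlgebra H} (W : WeightData H)
    (σ : ℝ → Op H → Op H) (Θ : VNAut M) : Prop :=
  (∀ x ∈ M, IsPos x → W.val (Θ.invFun x) = W.val x) ∧
  ∀ p, IsProjIn (flowFixed M σ) p → p ≠ 0 → W.val p ≠ ⊤ →
  ∀ h, CornerPosInvertibleIn (flowFixed M σ) p h →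
  ∀ k, k ∈ flowFixed M σ → IsPos k → k * k = h →
    Intertwined M (fun x => W.cval (k * Θ.invFun x * k)) (fun x => W.cval (k * x * k))

/-- `Θ` is locally pointwise inner for the faithful normal state `φ` with modular flow `σ`. -/
def LocallyPointwiseInnerS {M : VonNeumannAlgebra H} (φ : Op H → ℂ)
    (σ : ℝ → Op H → Op H) (Θ : VNAut M) : Prop :=
  (∀ x ∈ M, φ (Θ.invFun x) = φ x) ∧
  ∀ p, IsProjIn (flowFixed M σ) p → p ≠ 0 →
  ∀ h, CornerPosInvertibleIn (flowFixed M σ) p h →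
  ∀ k, k ∈ flowFixed M σ → IsPos k → k * k = h →
    Intertwined M (fun x => φ (k * Θ.invFun x * k)) (fun x => φ (k * x * k))

/-- `Θ` is locally pointwise inner for the faithful normal state `φ`, stated with the
algebraically-defined centralizer `M_φ = {x : φ(xy) = φ(yx)}`. -/
def LocallyPointwiseInnerC {M : VonNeumannAlgebra H} (φ : Op H → ℂ) (Θ : VNAut M) : Prop :=
  (∀ x ∈ M, φ (Θ.invFun x) = φ x) ∧
  ∀ p, IsProjIn (stateCentralizer M φ) p → p ≠ 0 →
  ∀ h, CornerPosInvertibleIn (stateCentralizer M φ) p h →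
  ∀ k, k ∈ stateCentralizer M φ → IsPos k → k * k = h →
    Intertwined M (fun x => φ (k * Θ.invFun x * k)) (fun x => φ (k * x * k))

/-- `E : M → N` is a faithful normal conditional expectation. -/
structure IsCondExp (M N : VonNeumannAlgebra H) (E : Op H → Op H) : Prop where
  subset' : (N : Set (Op H)) ⊆ (M : Set (Op H))
  mem' : ∀ x ∈ M, E x ∈ N
  fix' : ∀ x ∈ N, E x = x
  map_add' : ∀ x ∈ M, ∀ y ∈ M, E (x + y) = E x + E y
  map_smul' : ∀ (c : ℂ), ∀ x ∈ M, E (c • x) = c • E x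
  bimod' : ∀ a ∈ N, ∀ x ∈ M, ∀ b ∈ N, E (a * x * b) = a * E x * b
  map_star' : ∀ x ∈ M, E (star x) = star (E x)
  pos' : ∀ x ∈ M, IsPos x → IsPos (E x)
  faithful' : ∀ x ∈ M, IsPos x → E x = 0 → x = 0
  normal' : ∀ ρ : Op H → ℂ, IsNormalState N ρ → IsNormalState M (fun x => ρ (E x))

/-- The triple `(M, N, φ)` (with expectation `E : M → N`, `φ ∘ E = φ`) is
intertwining stable (Definition 4.1 of Houdayer–Isono). -/
def IntertwiningStable (M N : VonNeumannAlgebra H) (E : Op H → Op H)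
    (φ : Op H → ℂ) : Prop :=
  ∀ Θ : VNAut M,
    (∀ x ∈ M, E (Θ.toFun x) = Θ.toFun (E x)) →
    (∀ x ∈ M, φ (Θ.invFun x) = φ x) →
    ∀ ψ : Op H → ℂ, IsNormalPLF N ψ → (∃ x ∈ N, ψ x ≠ 0) →
      Intertwined M (fun x => ψ (E (Θ.invFun x))) (fun x => ψ (E x)) →
      Intertwined N (fun x => ψ (Θ.invFun x)) ψ

/-- `M = N ⊗̄ P`: `N` and `P` are commuting subalgebras of `M` which generate `M`
and admit normal product states (slice maps). -/
structure IsTensorDecomposition (M N P : VonNeumannAlgebra H) : Prop where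
  subN : (N : Set (Op H)) ⊆ (M : Set (Op H))
  subP : (P : Set (Op H)) ⊆ (M : Set (Op H))
  comm : ∀ x ∈ N, ∀ y ∈ P, x * y = y * x
  generates :
    Set.centralizer (Set.centralizer ((N : Set (Op H)) ∪ (P : Set (Op H)))) = (M : Set (Op H))
  slice : ∀ (ρN ρP : Op H → ℂ), IsNormalState N ρN → IsNormalState P ρP →
    ∃ ρ : Op H → ℂ, IsNormalState M ρ ∧ ∀ x ∈ N, ∀ y ∈ P, ρ (x * y) = ρN x * ρP y

/-- `E = id_N ⊗ φ_P : N ⊗̄ P → N` is the slice conditional expectation attached to `φ_P`. -/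
def IsSliceExpectation (M N P : VonNeumannAlgebra H) (φP : Op H → ℂ)
    (E : Op H → Op H) : Prop :=
  IsCondExp M N E ∧ ∀ x ∈ N, ∀ y ∈ P, E (x * y) = φP y • x

/-- `(M, φ) = (N, φN) ∗ (P, φP)`: `N` and `P` are subalgebras of `M` which generate `M`,
the state `φ` restricts to `φN`, `φP`, and `N`, `P` are free with respect to `φ`. -/
structure IsFreeProductDecomposition (M N P : VonNeumannAlgebra H)
    (φ φN φP : Op H → ℂ) : Prop where
  subN : (N : Set (Op H)) ⊆ (M : Set (Op H))
  subP : (P : Set (Op H)) ⊆ (M : Set (Op H))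
  generates :
    Set.centralizer (Set.centralizer ((N : Set (Op H)) ∪ (P : Set (Op H)))) = (M : Set (Op H))
  restN : ∀ x ∈ N, φ x = φN x
  restP : ∀ x ∈ P, φ x = φP x
  free : ∀ (n : ℕ) (x : Fin n → Op H) (ε : Fin n → Bool), n ≠ 0 →
    (∀ i, x i ∈ (if ε i then (N : Set (Op H)) else (P : Set (Op H)))) →
    (∀ i, φ (x i) = 0) →
    (∀ i j : Fin n, (i : ℕ) + 1 = (j : ℕ) → ε i ≠ ε j) →
    φ (List.ofFn x).prod = 0

/-- `f` restricts to a ∗-isomorphism `N ≅ P`. -/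
structure IsVNIso (N P : VonNeumannAlgebra H) (f : Op H → Op H) : Prop where
  mem' : ∀ x ∈ N, f x ∈ P
  surj' : ∀ y ∈ P, ∃ x ∈ N, f x = y
  inj' : ∀ x ∈ N, ∀ y ∈ N, f x = f y → x = y
  map_add' : ∀ x ∈ N, ∀ y ∈ N, f (x + y) = f x + f y
  map_smul' : ∀ (c : ℂ), ∀ x ∈ N, f (c • x) = c • f x
  map_mul' : ∀ x ∈ N, ∀ y ∈ N, f (x * y) = f x * f y
  map_star' : ∀ x ∈ N, f (star x) = star (f x)

/-- `M` satisfies the Haagerup–Størmer conjecture: an automorphism of `M` is pointwise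
inner iff it is the composition of an inner automorphism and a modular automorphism
`σ_t^χ` of some faithful normal state `χ`. -/
def SatisfiesHSC (M : VonNeumannAlgebra H) : Prop :=
  ∀ Θ : VNAut M, PointwiseInner Θ ↔
    ∃ (χ : Op H → ℂ) (σ : ℝ → Op H → Op H) (u : Op H) (t : ℝ),
      IsFNState M χ ∧ IsModularFlow M χ σ ∧ IsUnitaryIn (M : Set (Op H)) u ∧
      ∀ x ∈ M, Θ.toFun x = u * σ t x * star u

/-- `Λ` is a countable subgroup of `ℝ_{>0}`, dense in `ℝ_{>0}`. -/
def IsCountableDenseSubgroup (Λ : Set ℝ) : Prop :=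
  Λ ⊆ Set.Ioi (0 : ℝ) ∧ (1 : ℝ) ∈ Λ ∧ (∀ a ∈ Λ, ∀ b ∈ Λ, a * b ∈ Λ) ∧
    (∀ a ∈ Λ, a⁻¹ ∈ Λ) ∧ Λ.Countable ∧ Set.Ioi (0 : ℝ) ⊆ closure Λ

/-- `g` is a character of the (discrete) group `Λ < ℝ_{>0}`, i.e. an element of the dual
compact group `G = Λ̂` (only the values of `g` on `Λ` are relevant). -/
def IsCharacterOn (Λ : Set ℝ) (g : ℝ → ℂ) : Prop :=
  g 1 = 1 ∧ (∀ a ∈ Λ, ‖g a‖ = 1) ∧ ∀ a ∈ Λ, ∀ b ∈ Λ, g (a * b) = g a * g b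

/-- `Φ ∈ E_{M,φ}`: `Φ` is a faithful normal positive linear functional with
`s(φ) ∈ M_Φ` and `Φ s(φ) = s(φ) Φ = φ`. -/
def MemE (M : VonNeumannAlgebra H) (φ Φ : Op H → ℂ) : Prop :=
  IsNormalPLF M Φ ∧ IsFaithfulOn M Φ ∧
    ∃ p, IsSupportProjOf M φ p ∧ (∀ x ∈ M, Φ (p * x) = Φ (x * p)) ∧
      ∀ x ∈ M, Φ (p * x) = φ x

/-- `w = ([DΨ : DΦ]_t)_t` is the Connes Radon–Nikodym cocycle of the pair `(Ψ, Φ)` of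
faithful normal positive functionals (with `σΦ` the modular flow of `Φ`): the unique
σ-strongly continuous family of unitaries satisfying the cocycle identity and the
relative KMS condition. -/
structure IsConnesCocycle (M : VonNeumannAlgebra H) (Φ Ψ : Op H → ℂ)
    (σΦ : ℝ → Op H → Op H) (w : ℝ → Op H) : Prop where
  unitary' : ∀ t : ℝ, IsUnitaryIn (M : Set (Op H)) (w t)
  cocycle' : ∀ s t : ℝ, w (s + t) = w s * σΦ s (w t)
  continuous' : ∀ ξ : H, Continuous fun t : ℝ => w t ξ
  kms' : ∀ x ∈ M, ∀ y ∈ M, ∃ F : ℂ → ℂ, ContinuousOn F strip ∧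
    DifferentiableOn ℂ F stripo ∧ (∃ C : ℝ, ∀ z ∈ strip, ‖F z‖ ≤ C) ∧
    (∀ t : ℝ, F (t : ℂ) = Ψ (w t * σΦ t x * y)) ∧
    (∀ t : ℝ, F ((t : ℂ) + Complex.I) = Φ (y * (w t * σΦ t x)))

/-- `S` is a strongly dense subset of `M`. -/
def StronglyDenseIn (M : VonNeumannAlgebra H) (S : Set (Op H)) : Prop :=
  S ⊆ (M : Set (Op H)) ∧ ∀ x ∈ M, ∀ ε : ℝ, 0 < ε → ∀ Ξ : Finset H,
    ∃ y ∈ S, ∀ ξ ∈ Ξ, ‖(x - y) ξ‖ < ε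

/-- There is a net `(t_j)` in `ℝ` along which `φ(σ_{t_j}^Φ(b^*) w_{t_j}^* s(ψ) a) → 0`
for all `a, b ∈ S` (nets are encoded by maps out of a nontrivially filtered index type). -/
def VanishingNet (φ : Op H → ℂ) (σΦ : ℝ → Op H → Op H) (w : ℝ → Op H)
    (sψ : Op H) (S : Set (Op H)) : Prop :=
  ∃ (ι : Type) (l : Filter ι), l.NeBot ∧ ∃ t : ι → ℝ,
    ∀ a ∈ S, ∀ b ∈ S,
      Filter.Tendsto (fun j => φ (σΦ (t j) (star b) * (star (w (t j)) * (sψ * a))))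
        l (nhds (0 : ℂ))

/-- `(D, π, lam)` is the discrete core `d_{Λ,φ}(M) = M ⋊_{σ^{Λ,φ}} G` of `(M, φ)` with
respect to `Λ = σ_p(Δ_φ)` and `G = Λ̂`: `π` is a normal unital ∗-embedding of `M` into `D`,
`lam` implements `G` by unitaries of `D` satisfying the covariance relation
`λ_g π(x) λ_g^* = ⟨g, l⟩ π(x)` on `l`-eigenvectors, and `π(M)` together with the `λ_g`
generate `D`. -/
structure IsDiscreteCore {K : Type} [NormedAddCommGroup K] [InnerProductSpace ℂ K]
    [CompleteSpace K] (M : VonNeumannAlgebra H) (σ : ℝ → Op H → Op H)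
    (D : VonNeumannAlgebra K) (π : Op H → Op K) (lam : (ℝ → ℂ) → Op K) : Prop where
  mem' : ∀ x ∈ M, π x ∈ D
  inj' : ∀ x ∈ M, ∀ y ∈ M, π x = π y → x = y
  map_one' : π 1 = 1
  map_add' : ∀ x ∈ M, ∀ y ∈ M, π (x + y) = π x + π y
  map_smul' : ∀ (c : ℂ), ∀ x ∈ M, π (c • x) = c • π x
  map_mul' : ∀ x ∈ M, ∀ y ∈ M, π (x * y) = π x * π y
  map_star' : ∀ x ∈ M, π (star x) = star (π x)
  lam_unitary' : ∀ g, IsCharacterOn (pointSpectrum M σ) g →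
    IsUnitaryIn (D : Set (Op K)) (lam g)
  lam_one' : lam (fun _ => 1) = 1
  lam_mul' : ∀ g h, IsCharacterOn (pointSpectrum M σ) g →
    IsCharacterOn (pointSpectrum M σ) h → lam (fun r => g r * h r) = lam g * lam h
  covariance' : ∀ g, IsCharacterOn (pointSpectrum M σ) g →
    ∀ l ∈ pointSpectrum M σ, ∀ x, IsEigenvector M σ l x →
      lam g * π x * star (lam g) = g l • π x
  generates' : Set.centralizer (Set.centralizer
      ((π '' (M : Set (Op H))) ∪ (lam '' {g | IsCharacterOn (pointSpectrum M σ) g})))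
    = (D : Set (Op K))

section IntertwiningPreliminaries

open Filter Topology

section PositiveFunctionals

variable {M : VonNeumannAlgebra H} {φ ψ : Op H → ℂ}

theorem smul_mem_vonNeumann (c : ℂ) {x : Op H} (hx : x ∈ M) : c • x ∈ M :=
  M.toStarSubalgebra.smul_mem hx c

theorem isClosed_vonNeumann (M : VonNeumannAlgebra H) : IsClosed (M : Set (Op H)) := by
  rw [← M.centralizer_centralizer]
  exact Set.isClosed_centralizer _

theorem cfc_mem_vonNeumann (f : ℝ → ℝ) {a : Op H} (ha : a ∈ M) : cfc f a ∈ M := by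
  have : IsClosed (M.toStarSubalgebra : Set (Op H)) := isClosed_vonNeumann M
  exact cfc_mem (s := M.toStarSubalgebra) f ha

namespace IsPLF

theorem map_zero (h : IsPLF M φ) : φ 0 = 0 := by
  simpa using h.map_smul 0 0 (zero_mem M)

theorem map_neg (h : IsPLF M φ) {x : Op H} (hx : x ∈ M) : φ (-x) = -φ x := by
  simpa using h.map_smul (-1) x hx

theorem map_sub (h : IsPLF M φ) {x y : Op H} (hx : x ∈ M) (hy : y ∈ M) :
    φ (x - y) = φ x - φ y := by
  rw [sub_eq_add_neg, h.map_add x hx _ (neg_mem hy), h.map_neg hy, sub_eq_add_neg]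

theorem map_sum (h : IsPLF M φ) {ι : Type*} (s : Finset ι) {p : ι → Op H} (hp : ∀ i, p i ∈ M) :
    φ (∑ i ∈ s, p i) = ∑ i ∈ s, φ (p i) := by
  classical
  induction s using Finset.induction_on with
  | empty => simpa using h.map_zero
  | insert a s ha ih =>
    rw [Finset.sum_insert ha, Finset.sum_insert ha,
      h.map_add _ (hp a) _ (sum_mem fun i _ => hp i), ih]

theorem map_star (h : IsPLF M φ) {x : Op H} (hx : x ∈ M) :
    φ (star x) = starRingEnd ℂ (φ x) := by
  have key : ∀ c : ℂ, (φ 1 + c * φ x + starRingEnd ℂ c * φ (star x)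
      + starRingEnd ℂ c * c * φ (star x * x)).im = 0 := fun c => by
    have hc := smul_mem_vonNeumann c hx
    have h1 := h.pos (1 + c • x) (add_mem (one_mem M) hc)
    have e : star (1 + c • x) * (1 + c • x)
        = 1 + c • x + star c • star x + (star c * c) • (star x * x) := by
      simp only [star_add, star_one, star_smul, add_mul, mul_add, one_mul, mul_one, smul_mul_smul_comm]
      abel
    rw [e, h.map_add _ (add_mem (add_mem (one_mem M) hc) (smul_mem_vonNeumann _ (star_mem hx))) _
        (smul_mem_vonNeumann _ (mul_mem (star_mem hx) hx)),
      h.map_add _ (add_mem (one_mem M) hc) _ (smul_mem_vonNeumann _ (star_mem hx)),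
      h.map_add _ (one_mem M) _ hc, h.map_smul _ _ hx, h.map_smul _ _ (star_mem hx),
      h.map_smul _ _ (mul_mem (star_mem hx) hx)] at h1
    simpa using (Complex.le_def.1 h1).2.symm
  have h1 : (φ 1).im = 0 := by
    have := (Complex.le_def.1 (h.pos 1 (one_mem M))).2
    simpa using this.symm
  have h2 : (φ (star x * x)).im = 0 := by
    have := (Complex.le_def.1 (h.pos x hx)).2
    simpa using this.symm
  have k1 := key 1
  have k2 := key Complex.I
  simp [h1, h2] at k1 k2
  apply Complex.ext <;> simp <;> linarith

theorem nonneg (h : IsPLF M φ) {x : Op H} (hx : x ∈ M) (hx0 : 0 ≤ x) : 0 ≤ φ x := by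
  have hs := CFC.sqrt_mul_sqrt_self x hx0
  have hm : CFC.sqrt x ∈ M := by
    rw [CFC.sqrt_eq_real_sqrt x hx0, cfcₙ_eq_cfc]
    exact cfc_mem_vonNeumann _ hx
  have := h.pos _ hm
  rwa [(CFC.sqrt_nonneg x).isSelfAdjoint.star_eq, hs] at this

theorem mono (h : IsPLF M φ) {x y : Op H} (hx : x ∈ M) (hy : y ∈ M) (hxy : x ≤ y) :
    φ x ≤ φ y := by
  have := h.nonneg (sub_mem hy hx) (sub_nonneg.2 hxy)
  rwa [h.map_sub hy hx, sub_nonneg] at this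

theorem norm_apply_star_mul_sq_le (h : IsPLF M φ) {x y : Op H} (hx : x ∈ M) (hy : y ∈ M) :
    ‖φ (star x * y)‖ ^ 2 ≤ (φ (star x * x)).re * (φ (star y * y)).re := by
  let c : PreInnerProductSpace.Core ℂ M.toStarSubalgebra :=
    { inner := fun a b => φ (star (a : Op H) * b)
      conj_inner_symm := fun a b => by
        have := h.map_star (mul_mem (star_mem b.2) a.2 : star (b : Op H) * a ∈ M)
        simpa using this.symm
      re_inner_nonneg := fun a => (Complex.le_def.1 (h.pos a a.2)).1
      add_left := fun a b d => by
        have := h.map_add _ (mul_mem (star_mem a.2) d.2 : star (a : Op H) * d ∈ M) _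
          (mul_mem (star_mem b.2) d.2 : star (b : Op H) * d ∈ M)
        simpa [add_mul] using this
      smul_left := fun a b r => by
        have := h.map_smul (star r) _ (mul_mem (star_mem a.2) b.2 : star (a : Op H) * b ∈ M)
        simpa using this }
  have := InnerProductSpace.Core.inner_mul_inner_self_le (𝕜 := ℂ) (c := c) ⟨x, hx⟩ ⟨y, hy⟩
  have e : φ (star y * x) = starRingEnd ℂ (φ (star x * y)) := by
    have := h.map_star (mul_mem (star_mem hx) hy : star x * y ∈ M)
    simpa using this
  change ‖φ (star x * y)‖ * ‖φ (star y * x)‖ ≤ (φ (star x * x)).re * (φ (star y * y)).re at this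
  rwa [e, RCLike.norm_conj, ← sq] at this

theorem apply_star_mul_self_le (h : IsPLF M φ) {x : Op H} (hx : x ∈ M) :
    (φ (star x * x)).re ≤ ‖x‖ ^ 2 * (φ 1).re := by
  have h1 : star x * x ≤ algebraMap ℝ (Op H) (‖x‖ ^ 2) := CStarAlgebra.star_mul_le_algebraMap_norm_sq
  have e : algebraMap ℝ (Op H) (‖x‖ ^ 2) = ((‖x‖ ^ 2 : ℝ) : ℂ) • (1 : Op H) := by
    rw [Algebra.algebraMap_eq_smul_one, Complex.coe_smul]
  rw [e] at h1
  have h2 := (Complex.le_def.1 (h.mono (mul_mem (star_mem hx) hx)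
    (smul_mem_vonNeumann _ (one_mem M)) h1)).1
  rw [h.map_smul _ _ (one_mem M)] at h2
  simpa [← Complex.ofReal_pow] using h2

theorem norm_apply_le (h : IsPLF M φ) {x : Op H} (hx : x ∈ M) : ‖φ x‖ ≤ (φ 1).re * ‖x‖ := by
  have h0 : 0 ≤ (φ 1).re := (Complex.le_def.1 (by simpa using h.pos 1 (one_mem M))).1
  have h1 := h.norm_apply_star_mul_sq_le (one_mem M) hx
  have h2 := h.apply_star_mul_self_le hx
  simp only [star_one, one_mul] at h1
  refine abs_le_of_sq_le_sq' ?_ (by positivity) |>.2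
  calc _ ≤ _ := h1
    _ ≤ (φ 1).re * (‖x‖ ^ 2 * (φ 1).re) := by gcongr
    _ = _ := by ring

end IsPLF

end PositiveFunctionals

section Centralizer

variable {M : VonNeumannAlgebra H} {φ ψ : Op H → ℂ}

/-- The centralizer of a positive functional as a unital `*`-subalgebra. -/
def centralizerSubalgebra (h : IsPLF M φ) : StarSubalgebra ℂ (Op H) where
  carrier := stateCentralizer M φ
  mul_mem' := fun {a b} ha hb => ⟨mul_mem ha.1 hb.1, fun y hy => by
    rw [mul_assoc, ha.2 _ (mul_mem hb.1 hy), mul_assoc, hb.2 _ (mul_mem hy ha.1), mul_assoc]⟩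
  add_mem' := fun {a b} ha hb => ⟨add_mem ha.1 hb.1, fun y hy => by
    rw [add_mul, mul_add, h.map_add _ (mul_mem ha.1 hy) _ (mul_mem hb.1 hy),
      h.map_add _ (mul_mem hy ha.1) _ (mul_mem hy hb.1), ha.2 y hy, hb.2 y hy]⟩
  algebraMap_mem' := fun c => ⟨algebraMap_mem M.toStarSubalgebra c, fun y _ => by
    rw [Algebra.commutes]⟩
  star_mem' := fun {a} ha => ⟨star_mem ha.1, fun y hy => by
    have e := ha.2 _ (star_mem hy)
    have e1 := h.map_star (mul_mem ha.1 (star_mem hy))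
    have e2 := h.map_star (mul_mem (star_mem hy) ha.1)
    rw [star_mul, star_star] at e1 e2
    rw [e1, e2, e]⟩

theorem isClosed_stateCentralizer (h : IsPLF M φ) :
    IsClosed (stateCentralizer M φ : Set (Op H)) := by
  refine isClosed_of_closure_subset fun x hx => ?_
  have hxM : x ∈ M := closure_minimal (fun y hy => hy.1) (isClosed_vonNeumann M) hx
  refine ⟨hxM, fun y hy => ?_⟩
  have bound : ∀ z ∈ stateCentralizer M φ,
      ‖φ (x * y) - φ (y * x)‖ ≤ 2 * (φ 1).re * ‖y‖ * ‖x - z‖ := fun z hz => by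
    have h0 : 0 ≤ (φ 1).re := (Complex.le_def.1 (by simpa using h.pos 1 (one_mem M))).1
    have e : φ (x * y) - φ (y * x) = φ ((x - z) * y) - φ (y * (x - z)) := by
      rw [sub_mul, mul_sub, h.map_sub (mul_mem hxM hy) (mul_mem hz.1 hy),
        h.map_sub (mul_mem hy hxM) (mul_mem hy hz.1), hz.2 y hy]
      ring
    have hd := sub_mem hxM hz.1
    calc ‖φ (x * y) - φ (y * x)‖ ≤ ‖φ ((x - z) * y)‖ + ‖φ (y * (x - z))‖ := e ▸ norm_sub_le _ _
      _ ≤ (φ 1).re * ‖(x - z) * y‖ + (φ 1).re * ‖y * (x - z)‖ :=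
        add_le_add (h.norm_apply_le (mul_mem hd hy)) (h.norm_apply_le (mul_mem hy hd))
      _ ≤ (φ 1).re * (‖x - z‖ * ‖y‖) + (φ 1).re * (‖y‖ * ‖x - z‖) := by
        gcongr <;> exact norm_mul_le _ _
      _ = _ := by ring
  obtain ⟨u, hu, hlim⟩ := mem_closure_iff_seq_limit.1 hx
  have ht : Tendsto (fun n => 2 * (φ 1).re * ‖y‖ * ‖x - u n‖) atTop (𝓝 0) := by
    simpa using ((tendsto_const_nhds (x := x)).sub hlim).norm.const_mul (2 * (φ 1).re * ‖y‖)
  have := ge_of_tendsto' ht fun n => bound _ (hu n)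
  exact sub_eq_zero.1 (norm_le_zero_iff.1 this)

theorem cfc_mem_centralizerSubalgebra (h : IsPLF M φ) (f : ℝ → ℝ) {a : Op H}
    (ha : a ∈ centralizerSubalgebra h) : cfc f a ∈ centralizerSubalgebra h := by
  have : IsClosed (centralizerSubalgebra h : Set (Op H)) := isClosed_stateCentralizer h
  exact cfc_mem (s := centralizerSubalgebra h) f ha

/-- A self-adjoint element approximated by elements of the centralizer in the `L²`-seminorm of the
functional belongs to the centralizer. -/
theorem mem_centralizer_of_tendsto (h : IsPLF M φ) {ι : Type*} {l : Filter ι} [l.NeBot]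
    {q : Op H} {b : ι → Op H} (hq : q ∈ M) (hqs : star q = q)
    (hb : ∀ i, b i ∈ centralizerSubalgebra h) (hbs : ∀ i, star (b i) = b i)
    (ht : Tendsto (fun i => (φ ((q - b i) * (q - b i))).re) l (𝓝 0)) :
    q ∈ centralizerSubalgebra h := by
  refine ⟨hq, fun y hy => ?_⟩
  have bound : ∀ i, ‖φ (q * y) - φ (y * q)‖ ≤
      √((φ ((q - b i) * (q - b i))).re * (φ (star y * y)).re) +
      √((φ (y * star y)).re * (φ ((q - b i) * (q - b i))).re) := fun i => by
    have hd : q - b i ∈ M := sub_mem hq (hb i).1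
    have hds : star (q - b i) = q - b i := by rw [star_sub, hqs, hbs]
    have e : φ (q * y) - φ (y * q) = φ ((q - b i) * y) - φ (y * (q - b i)) := by
      rw [sub_mul, mul_sub, h.map_sub (mul_mem hq hy) (mul_mem (hb i).1 hy),
        h.map_sub (mul_mem hy hq) (mul_mem hy (hb i).1), (hb i).2 y hy]
      ring
    have h1 := h.norm_apply_star_mul_sq_le hd hy
    have h2 := h.norm_apply_star_mul_sq_le (star_mem hy) hd
    rw [hds] at h1 h2
    rw [star_star] at h2
    rw [e]
    exact (norm_sub_le _ _).trans (add_le_add (Real.le_sqrt_of_sq_le h1) (Real.le_sqrt_of_sq_le h2))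
  have ht' : Tendsto (fun i => √((φ ((q - b i) * (q - b i))).re * (φ (star y * y)).re) +
      √((φ (y * star y)).re * (φ ((q - b i) * (q - b i))).re)) l (𝓝 0) := by
    simpa using (ht.mul_const _).sqrt.add (ht.const_mul _).sqrt
  exact sub_eq_zero.1 (norm_le_zero_iff.1 (ge_of_tendsto' ht' bound))

end Centralizer

section Projections

variable {M : VonNeumannAlgebra H} {φ ψ : Op H → ℂ}

theorem starProjection_mem_vonNeumann (K : Submodule ℂ H) [K.HasOrthogonalProjection]
    (hK : ∀ y ∈ M.commutant, ∀ ξ ∈ K, y ξ ∈ K) : IsProjIn (M : Set (Op H)) K.starProjection := by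
  have hs : IsStarProjection K.starProjection := isStarProjection_starProjection
  refine ⟨(VonNeumannAlgebra.IsStarProjection.mem_iff hs M).2 fun y hy => ?_,
    hs.isSelfAdjoint.star_eq, hs.isIdempotentElem.eq⟩
  rw [Submodule.range_starProjection]
  exact fun ξ hξ => hK y hy ξ hξ

theorem sum_mul_sum_of_orthogonal {R ι : Type*} [Ring R] [DecidableEq ι] {p : ι → R}
    (hp : ∀ i, p i * p i = p i) (hpo : Pairwise fun i j => p i * p j = 0) {s t : Finset ι}
    (hst : s ⊆ t) : (∑ i ∈ t, p i) * ∑ i ∈ s, p i = ∑ i ∈ s, p i := by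
  rw [Finset.mul_sum]
  refine Finset.sum_congr rfl fun i hi => ?_
  rw [Finset.sum_mul, Finset.sum_eq_single i (fun j _ hj => hpo hj)
    (fun hi' => absurd (hst hi) hi'), hp]

theorem exists_hasSum_of_orthogonal {ι : Type*} {p : ι → Op H}
    (hp : ∀ i, IsProjIn (M : Set (Op H)) (p i)) (hpo : Pairwise fun i j => p i * p j = 0) :
    ∃ q, IsProjIn (M : Set (Op H)) q ∧ ∀ ξ, HasSum (fun i => p i ξ) (q ξ) := by
  classical
  have hs : ∀ s : Finset ι, IsStarProjection (∑ i ∈ s, p i) := fun s =>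
    ⟨sum_mul_sum_of_orthogonal (fun i => (hp i).2.2) hpo subset_rfl, by
      simp [IsSelfAdjoint, star_sum, (hp _).2.1]⟩
  have hproj : ∀ s : Finset ι, ∃ K : Submodule ℂ H, ∃ _ : K.HasOrthogonalProjection,
      ∑ i ∈ s, p i = K.starProjection := fun s => isStarProjection_iff_eq_starProjection.1 (hs s)
  choose U hU hUe using hproj
  have hmem : ∀ s ξ, ξ ∈ U s ↔ (∑ i ∈ s, p i) ξ = ξ := fun s ξ => by
    rw [hUe, Submodule.starProjection_eq_self_iff]
  have hmono : Monotone U := fun s t hst ξ hξ => by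
    rw [hmem] at hξ ⊢
    rw [← hξ, ← mul_apply_eq_comp,
      sum_mul_sum_of_orthogonal (fun i => (hp i).2.2) hpo hst]
  refine ⟨(⨆ s, U s).topologicalClosure.starProjection,
    starProjection_mem_vonNeumann _ fun y hy ξ hξ => ?_, fun ξ => ?_⟩
  · have hinv : (⨆ s, U s) ≤ (⨆ s, U s).comap (y : H →ₗ[ℂ] H) := iSup_le fun s ξ hξ => by
      refine Submodule.mem_iSup_of_mem s ?_
      rw [hmem] at hξ ⊢
      have hc := VonNeumannAlgebra.mem_commutant_iff.1 hy _ (sum_mem fun i (_ : i ∈ s) => (hp i).1)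
      have := congr($hc ξ)
      simp only [mul_apply_eq_comp, hξ] at this
      exact this
    exact map_mem_closure y.continuous hξ hinv
  · have := Submodule.starProjection_tendsto_closure_iSup U hmono ξ
    refine this.congr fun s => ?_
    rw [← hUe]
    simp

theorem mul_eq_zero_of_hasSum {ι : Type*} {p : ι → Op H} {q y : Op H}
    (hq : ∀ ξ, HasSum (fun i => p i ξ) (q ξ)) (h : ∀ i, y * p i = 0) : y * q = 0 := by
  ext ξ
  have h1 := y.hasSum (hq ξ)
  have h2 : (fun i => y (p i ξ)) = fun _ => 0 := funext fun i => congr($(h i) ξ)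
  rw [h2] at h1
  exact h1.unique hasSum_zero

theorem mul_eq_self_of_hasSum {ι : Type*} {p : ι → Op H} {q : Op H}
    (hp : ∀ i, p i * p i = p i) (hpo : Pairwise fun i j => p i * p j = 0)
    (hq : ∀ ξ, HasSum (fun i => p i ξ) (q ξ)) (i : ι) : q * p i = p i := by
  ext ξ
  refine (hq (p i ξ)).unique ?_
  have := hasSum_single (f := fun j => p j (p i ξ)) i fun j hj => congr($(hpo hj) ξ)
  rwa [show p i (p i ξ) = p i ξ from congr($(hp i) ξ)] at this

/-- A strong sum of orthogonal projections of the centralizer lies in the centralizer. -/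
theorem hasSum_mem_centralizer (h : IsNormalPLF M φ) {ι : Type} {p : ι → Op H} {q : Op H}
    (hp : ∀ i, IsProjIn (stateCentralizer M φ) (p i)) (hpo : Pairwise fun i j => p i * p j = 0)
    (hqp : IsProjIn (M : Set (Op H)) q) (hq : ∀ ξ, HasSum (fun i => p i ξ) (q ξ)) :
    q ∈ stateCentralizer M φ := by
  classical
  have hqs := h.normal ι p q (fun i => ⟨(hp i).1.1, (hp i).2⟩) hqp hpo hq
  have hbs : ∀ s : Finset ι, star (∑ i ∈ s, p i) = ∑ i ∈ s, p i := fun s => by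
    simp [star_sum, (hp _).2.1]
  refine mem_centralizer_of_tendsto h.toIsPLF (l := atTop) (b := fun s : Finset ι => ∑ i ∈ s, p i)
    hqp.1 hqp.2.1 (fun s => sum_mem fun i _ => (hp i).1) hbs ?_
  have e : ∀ s : Finset ι, φ ((q - ∑ i ∈ s, p i) * (q - ∑ i ∈ s, p i))
      = φ q - ∑ i ∈ s, φ (p i) := fun s => by
    have h1 : q * ∑ i ∈ s, p i = ∑ i ∈ s, p i := by
      rw [Finset.mul_sum]
      exact Finset.sum_congr rfl fun i _ => mul_eq_self_of_hasSum (fun i => (hp i).2.2) hpo hq i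
    have h2 : (∑ i ∈ s, p i) * q = ∑ i ∈ s, p i := by
      have := congr(star $h1)
      rwa [star_mul, hbs, hqp.2.1] at this
    have h3 := sum_mul_sum_of_orthogonal (fun i => (hp i).2.2) hpo (subset_refl s)
    have hm : ∑ i ∈ s, p i ∈ M := sum_mem fun i _ => (hp i).1.1
    rw [sub_mul, mul_sub, mul_sub, hqp.2.2, h1, h2, h3, sub_self, sub_zero,
      h.map_sub hqp.1 hm, h.map_sum s fun i => (hp i).1.1]
  simp_rw [e]
  have := (Complex.continuous_re.tendsto _).comp ((tendsto_const_nhds (x := φ q)).sub hqs)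
  simpa [Function.comp_def] using this

end Projections

section RangeProjection

variable {M : VonNeumannAlgebra H} {φ : Op H → ℂ}

/-- An increasing sequence of projections has a supremum, and a normal functional is continuous
along it. -/
theorem exists_limit_of_increasing_projections (h : IsNormalPLF M φ) {R : ℕ → Op H}
    (hR : ∀ n, IsProjIn (M : Set (Op H)) (R n)) (h0 : R 0 = 0)
    (hmono : ∀ n, R (n + 1) * R n = R n) :
    ∃ P, IsProjIn (M : Set (Op H)) P ∧ (∀ n, P * R n = R n) ∧
      (∀ y : Op H, (∀ n, y * R n = 0) → y * P = 0) ∧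
      Tendsto (fun n => φ (R n)) atTop (𝓝 (φ P)) := by
  have hle : ∀ m n, m ≤ n → R n * R m = R m := fun m n hmn => by
    induction n, hmn using Nat.le_induction with
    | base => exact (hR m).2.2
    | succ n _ ih => rw [← ih, ← mul_assoc, hmono]
  have hle' : ∀ m n, m ≤ n → R m * R n = R m := fun m n hmn => by
    have := congr(star $(hle m n hmn))
    rwa [star_mul, (hR m).2.1, (hR n).2.1] at this
  have hd : ∀ n, IsProjIn (M : Set (Op H)) (R (n + 1) - R n) := fun n =>
    ⟨sub_mem (hR _).1 (hR _).1, by rw [star_sub, (hR _).2.1, (hR _).2.1], by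
      rw [sub_mul, mul_sub, mul_sub, hmono, (hR _).2.2, (hR _).2.2, hle' _ _ n.le_succ]
      abel⟩
  have hlt : ∀ m n, m < n → (R (n + 1) - R n) * (R (m + 1) - R m) = 0 := fun m n hmn => by
    rw [sub_mul, mul_sub, mul_sub, hle _ _ (by omega), hle _ _ (by omega), hle _ _ (by omega),
      hle _ _ (by omega), sub_self]
  have hpo : Pairwise fun m n => (R (m + 1) - R m) * (R (n + 1) - R n) = 0 := fun m n hmn => by
    rcases hmn.lt_or_gt with hl | hl
    · have := congr(star $(hlt m n hl))
      rwa [star_mul, (hd m).2.1, (hd n).2.1, star_zero] at this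
    · exact hlt n m hl
  obtain ⟨P, hP, hsum⟩ := exists_hasSum_of_orthogonal hd hpo
  refine ⟨P, hP, fun n => ?_, fun y hy => mul_eq_zero_of_hasSum hsum fun n => ?_, ?_⟩
  · induction n with
    | zero => rw [h0, mul_zero]
    | succ n ih =>
      have := mul_eq_self_of_hasSum (fun i => (hd i).2.2) hpo hsum n
      rw [mul_sub, ih] at this
      exact sub_left_inj.1 this
  · rw [mul_sub, hy, hy, sub_zero]
  · have := (h.normal ℕ _ P hd hP hpo hsum).tendsto_sum_nat
    refine this.congr fun n => ?_
    rw [Finset.sum_congr rfl fun i _ => h.map_sub (hR (i + 1)).1 (hR i).1,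
      Finset.sum_range_sub (fun n => φ (R n)), h0, h.map_zero, sub_zero]

/-- The projection onto the kernel of an operator of `M`. -/
theorem exists_kernel_projection {u : Op H} (hu : u ∈ M) :
    ∃ R, IsProjIn (M : Set (Op H)) R ∧ u * R = 0 ∧ ∀ x : Op H, u * x = 0 → R * x = x := by
  have hcl : IsClosed (LinearMap.ker (u : H →ₗ[ℂ] H) : Set H) := u.isClosed_ker
  have : CompleteSpace (LinearMap.ker (u : H →ₗ[ℂ] H)) := hcl.completeSpace_coe
  refine ⟨(LinearMap.ker (u : H →ₗ[ℂ] H)).starProjection,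
    starProjection_mem_vonNeumann _ fun y hy ξ hξ => ?_, ?_, fun x hx => ?_⟩
  · have hc := congr($(VonNeumannAlgebra.mem_commutant_iff.1 hy u hu) ξ)
    simp only [mul_apply_eq_comp, LinearMap.mem_ker] at hc hξ ⊢
    exact hc.trans (by rw [show u ξ = 0 from hξ, _root_.map_zero])
  · ext ξ
    have := Submodule.starProjection_apply_mem (LinearMap.ker (u : H →ₗ[ℂ] H)) ξ
    exact LinearMap.mem_ker.1 this
  · ext ξ
    exact Submodule.starProjection_eq_self_iff.2 (LinearMap.mem_ker.2 congr($hx ξ))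

/-- The centralizer contains the range projections of its positive elements. -/
theorem exists_range_projection (h : IsNormalPLF M φ) {c : Op H} (hc : c ∈ stateCentralizer M φ)
    (hc0 : 0 ≤ c) :
    ∃ P, IsProjIn (stateCentralizer M φ) P ∧ P * c = c ∧
      ∀ y : Op H, y * c = 0 → y * P = 0 := by
  have hsp : ∀ t ∈ spectrum ℝ c, 0 ≤ t := fun t ht => spectrum_nonneg_of_nonneg hc0 ht
  have hcs : IsSelfAdjoint c := hc0.isSelfAdjoint
  set u : ℕ → Op H := fun n => cfc (fun t : ℝ => max (1 - n * t) 0) c with hu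
  have huA : ∀ n, u n ∈ centralizerSubalgebra h.toIsPLF := fun n =>
    cfc_mem_centralizerSubalgebra h.toIsPLF _ hc
  have hus : ∀ n, star (u n) = u n := fun n => (cfc_predicate _ c : IsSelfAdjoint (u n)).star_eq
  have hu0 : u 0 = 1 := by simp [hu, cfc_const_one ℝ c]
  have hstep : ∀ n, ∃ g : Op H, u (n + 1) = g * u n := fun n => by
    have hpos : ∀ t : ℝ, max (1 - n * t) (1 / (n + 1)) ≠ 0 := fun t =>
      (lt_max_of_lt_right (by positivity)).ne'
    have hcont : Continuous fun t : ℝ => max (1 - (n + 1) * t) 0 / max (1 - n * t) (1 / (n + 1)) :=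
      Continuous.div (by fun_prop) (by fun_prop) hpos
    refine ⟨cfc (fun t : ℝ => max (1 - (n + 1) * t) 0 / max (1 - n * t) (1 / (n + 1))) c, ?_⟩
    rw [hu, ← cfc_mul _ _ c hcont.continuousOn (by fun_prop)]
    refine cfc_congr fun t ht => ?_
    have hn : (0 : ℝ) < n + 1 := by positivity
    push_cast
    rcases le_total t (1 / (n + 1)) with h1 | h1
    · have h2 : 1 / ((n : ℝ) + 1) ≤ 1 - n * t := by
        rw [le_div_iff₀ hn] at h1
        rw [div_le_iff₀ hn]
        nlinarith
      have h3 : (0 : ℝ) < 1 / (n + 1) := by positivity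
      rw [max_eq_left h2, max_eq_left (a := 1 - n * t) (by linarith), div_mul_cancel₀]
      linarith
    · have : 1 - ((n : ℝ) + 1) * t ≤ 0 := by
        rw [div_le_iff₀ hn] at h1
        linarith
      simp [max_eq_right this]
  have hfac : ∀ n, ∃ g : Op H, 1 - u n = c * g := fun n => by
    have hpos : ∀ t : ℝ, max (n * t) 1 ≠ 0 := fun t => (lt_max_of_lt_right one_pos).ne'
    have hcont : Continuous fun t : ℝ => (n : ℝ) / max (n * t) 1 :=
      Continuous.div (by fun_prop) (by fun_prop) hpos
    refine ⟨cfc (fun t : ℝ => (n : ℝ) / max (n * t) 1) c, ?_⟩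
    have e := cfc_mul (fun t : ℝ => t) (fun t : ℝ => (n : ℝ) / max (n * t) 1) c (by fun_prop)
      hcont.continuousOn
    rw [cfc_id' ℝ c] at e
    rw [← e, hu, ← cfc_const_one ℝ c, ← cfc_sub _ _ c (by fun_prop) (by fun_prop)]
    refine cfc_congr fun t ht => ?_
    have h0 := hsp t ht
    rcases le_total (n * t) 1 with h1 | h1
    · rw [max_eq_left (by linarith), max_eq_right h1]
      ring
    · rw [max_eq_right (by linarith), max_eq_left h1, mul_div_assoc', mul_comm t,
        div_self (by linarith), sub_zero]
  choose R hR hRu hRr using fun n => exists_kernel_projection (huA n).1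
  have hR0 : R 0 = 0 := by simpa [hu0] using hRu 0
  have hmono : ∀ n, R (n + 1) * R n = R n := fun n => hRr _ _ <| by
    obtain ⟨g, hg⟩ := hstep n
    rw [hg, mul_assoc, hRu, mul_zero]
  obtain ⟨P, hP, hPR, hPy, hlim⟩ := exists_limit_of_increasing_projections h hR hR0 hmono
  have hPc : P * c = c := by
    set k : ℕ → Op H := fun n => cfc (fun t : ℝ => max (t - 1 / (n + 1)) 0) c with hk
    have huk : ∀ n, u (n + 1) * k n = 0 := fun n => by
      rw [hu, hk, ← cfc_mul _ _ c (by fun_prop) (by fun_prop), ← cfc_const_zero ℝ c]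
      refine cfc_congr fun t ht => ?_
      have hn : (0 : ℝ) < n + 1 := by positivity
      push_cast
      rcases le_total t (1 / (n + 1)) with h1 | h1
      · rw [max_eq_right (a := t - _) (by linarith), mul_zero]
      · rw [div_le_iff₀ hn] at h1
        rw [max_eq_right (by linarith), zero_mul]
    have hPk : ∀ n, P * k n = k n := fun n => by
      rw [← hRr _ _ (huk n), ← mul_assoc, hPR]
    have hkc : Tendsto k atTop (𝓝 c) := by
      refine tendsto_iff_norm_sub_tendsto_zero.2
        (squeeze_zero (fun n => norm_nonneg _) (fun n => ?_) tendsto_one_div_add_atTop_nhds_zero_nat)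
      have e := cfc_sub (fun t : ℝ => max (t - 1 / (n + 1)) 0) (fun t : ℝ => t) c (by fun_prop)
        (by fun_prop)
      rw [cfc_id' ℝ c] at e
      rw [hk, ← e]
      refine norm_cfc_le (by positivity) fun t ht => ?_
      have h0 := hsp t ht
      have hn : (0 : ℝ) < 1 / (n + 1) := by positivity
      rw [Real.norm_eq_abs, abs_le]
      rcases le_total (t - 1 / ((n : ℝ) + 1)) 0 with h1 | h1
      · rw [max_eq_right h1]; constructor <;> linarith
      · rw [max_eq_left h1]; constructor <;> linarith
    have h1 : Tendsto (fun n => P * k n) atTop (𝓝 (P * c)) := hkc.const_mul P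
    simp_rw [hPk] at h1
    exact tendsto_nhds_unique h1 hkc
  have hPy' : ∀ y : Op H, y * c = 0 → y * P = 0 := fun y hy => hPy y fun n => by
    obtain ⟨g, hg⟩ := hfac n
    have : R n = (1 - u n) * R n := by rw [sub_mul, hRu, sub_zero, one_mul]
    rw [this, hg, ← mul_assoc, ← mul_assoc, hy, zero_mul, zero_mul]
  refine ⟨P, ⟨?_, hP.2⟩, hPc, hPy'⟩
  have hbs : ∀ n, star (1 - u n) = 1 - u n := fun n => by rw [star_sub, star_one, hus]
  refine mem_centralizer_of_tendsto h.toIsPLF (l := atTop) (b := fun n => 1 - u n) hP.1 hP.2.1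
    (fun n => sub_mem (one_mem _) (huA n)) hbs ?_
  have hbound : ∀ n, (φ ((P - (1 - u n)) * (P - (1 - u n)))).re ≤
      4 * ((φ P).re - (φ (R n)).re) := fun n => by
    set D := P - (1 - u n) with hD
    have hDM : D ∈ M := sub_mem hP.1 (sub_mem (one_mem M) (huA n).1)
    have hDs : star D = D := by rw [hD, star_sub, hP.2.1, hbs]
    have hPb : P * (1 - u n) = 1 - u n := by
      obtain ⟨g, hg⟩ := hfac n
      rw [hg, ← mul_assoc, hPc]
    have hbP : (1 - u n) * P = 1 - u n := by
      have := congr(star $hPb)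
      rwa [star_mul, hbs, hP.2.1] at this
    have hDP : D * P = D := by rw [hD, sub_mul, hP.2.2, hbP]
    have hDR : D * R n = 0 := by
      rw [hD, sub_mul, sub_mul, hPR, hRu, one_mul, sub_zero, sub_self]
    have hRP : R n * P = R n := by
      have := congr(star $(hPR n))
      rwa [star_mul, (hR n).2.1, hP.2.1] at this
    set E := P - R n with hE
    have hEM : E ∈ M := sub_mem hP.1 (hR n).1
    have hEs : star E = E := by rw [hE, star_sub, hP.2.1, (hR n).2.1]
    have hEE : E * E = E := by
      rw [hE, sub_mul, mul_sub, mul_sub, hP.2.2, hPR, hRP, (hR n).2.2]; abel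
    have hDE : D * E = D := by rw [hE, mul_sub, hDP, hDR, sub_zero]
    have hnu : ‖u n‖ ≤ 1 := norm_cfc_le zero_le_one fun t ht => by
      have h0 := hsp t ht
      have : 0 ≤ (n : ℝ) * t := by positivity
      rw [Real.norm_eq_abs, abs_of_nonneg (le_max_right _ _)]
      exact max_le (by linarith) zero_le_one
    have hDn : ‖D‖ ≤ 2 := by
      have hP1 : ‖1 - P‖ ≤ 1 := by
        refine IsStarProjection.norm_le _ ⟨?_, ?_⟩
        · rw [IsIdempotentElem, sub_mul, mul_sub, mul_sub, hP.2.2]; simp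
        · rw [IsSelfAdjoint, star_sub, hP.2.1, star_one]
      have e : D = u n - (1 - P) := by rw [hD]; abel
      calc ‖D‖ ≤ ‖u n‖ + ‖1 - P‖ := e ▸ norm_sub_le _ _
        _ ≤ 2 := by linarith
    have h1 : star D * D ≤ algebraMap ℝ (Op H) (‖D‖ ^ 2) :=
      CStarAlgebra.star_mul_le_algebraMap_norm_sq
    have h2 := star_left_conjugate_le_conjugate h1 E
    have e1 : star E * (star D * D) * E = D * D := by
      rw [← mul_assoc, ← star_mul, mul_assoc, hDE, hDs]
    have e2 : star E * algebraMap ℝ (Op H) (‖D‖ ^ 2) * E = ((‖D‖ ^ 2 : ℝ) : ℂ) • E := by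
      rw [Algebra.algebraMap_eq_smul_one, mul_smul_comm, mul_one, smul_mul_assoc, hEs, hEE,
        Complex.coe_smul]
    rw [e1, e2] at h2
    have h3 := (Complex.le_def.1 (h.mono (mul_mem hDM hDM) (smul_mem_vonNeumann _ hEM) h2)).1
    have hEpos : 0 ≤ (φ E).re := by
      have := (Complex.le_def.1 (h.pos E hEM)).1
      rwa [hEs, hEE] at this
    have hEφ : (φ E).re = (φ P).re - (φ (R n)).re := by
      rw [hE, h.map_sub hP.1 (hR n).1, Complex.sub_re]
    rw [h.map_smul _ _ hEM, Complex.re_ofReal_mul, ← hEφ] at *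
    calc _ ≤ _ := h3
      _ ≤ 2 ^ 2 * (φ E).re := by gcongr
      _ = _ := by ring
  have hnn : ∀ n, 0 ≤ (φ ((P - (1 - u n)) * (P - (1 - u n)))).re := fun n => by
    have := (Complex.le_def.1 (h.pos (P - (1 - u n))
      (sub_mem hP.1 (sub_mem (one_mem M) (huA n).1)))).1
    rwa [star_sub, hP.2.1, hbs] at this
  refine squeeze_zero hnn hbound ?_
  have := ((Complex.continuous_re.tendsto _).comp hlim).const_sub (φ P).re |>.const_mul 4
  simpa [Function.comp_def] using this

end RangeProjection

section Factor

variable {M : VonNeumannAlgebra H} {φ ψ : Op H → ℂ}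

/-- In a centralizer which is a factor, no two nonzero projections are centrally orthogonal. -/
theorem exists_mul_mul_ne_zero (h : IsNormalPLF M φ) (hfac : IsFactorSet (stateCentralizer M φ))
    {e₁ e₂ : Op H} (he₁ : e₁ ≠ 0) (he₂ : IsProjIn (stateCentralizer M φ) e₂) (he₂0 : e₂ ≠ 0) :
    ∃ u ∈ stateCentralizer M φ, e₁ * u * e₂ ≠ 0 := by
  by_contra! hzero
  let A := centralizerSubalgebra h.toIsPLF
  let S : Set (Op H) := {p | IsProjIn (stateCentralizer M φ) p ∧ p ≠ 0 ∧ ∀ u ∈ A, e₁ * u * p = 0}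
  obtain ⟨T, ⟨hTS, hTo⟩, hTmax⟩ := zorn_subset
    {T : Set (Op H) | T ⊆ S ∧ T.Pairwise fun p q => p * q = 0} fun C hC hchain =>
      ⟨⋃₀ C, ⟨Set.sUnion_subset fun T hT => (hC hT).1,
        (Set.pairwise_sUnion hchain.directedOn).2 fun T hT => (hC hT).2⟩,
        fun T hT => Set.subset_sUnion_of_mem hT⟩
  have hp : ∀ p : T, IsProjIn (stateCentralizer M φ) (p : Op H) := fun p => (hTS p.2).1
  have hpo : Pairwise fun p q : T => (p : Op H) * q = 0 := fun p q hpq =>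
    hTo p.2 q.2 (Subtype.coe_injective.ne hpq)
  obtain ⟨q, hq, hsum⟩ := exists_hasSum_of_orthogonal
    (M := M) (p := fun p : T => (p : Op H)) (fun p => ⟨(hp p).1.1, (hp p).2⟩) hpo
  have hqA : q ∈ A := hasSum_mem_centralizer h hp hpo hq hsum
  have hqT : ∀ p ∈ T, q * p = p := fun p hpT =>
    mul_eq_self_of_hasSum (p := fun p : T => (p : Op H)) (fun p => (hp p).2.2) hpo hsum ⟨p, hpT⟩
  have hTq : ∀ p ∈ T, p * q = p := fun p hpT => by
    have := congr(star $(hqT p hpT))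
    rwa [star_mul, hq.2.1, (hp ⟨p, hpT⟩).2.1] at this
  have hqz : ∀ u ∈ A, e₁ * u * q = 0 := fun u hu =>
    mul_eq_zero_of_hasSum hsum fun p => (hTS p.2).2.2 u hu
  have hmax : ∀ p ∈ S, q * p ≠ 0 := fun p hpS hqp => by
    have hpq : p * q = 0 := by
      have := congr(star $hqp)
      rwa [star_mul, hq.2.1, hpS.1.2.1, star_zero] at this
    have hins : insert p T ∈ {T : Set (Op H) | T ⊆ S ∧ T.Pairwise fun p q => p * q = 0} :=
      ⟨Set.insert_subset hpS hTS, hTo.insert fun t ht _ =>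
        ⟨by rw [← hqT t ht, ← mul_assoc, hpq, zero_mul],
          by rw [← hTq t ht, mul_assoc, hqp, mul_zero]⟩⟩
    have hpT := hTmax hins (Set.subset_insert p T) (Set.mem_insert p T)
    exact hpS.2.1 (by rw [← hqT p hpT, hqp])
  have hcut : ∀ x ∈ A, x * q = q * x * q := fun x hx => by
    by_contra hne
    set z := x * q - q * x * q with hz
    have hz0 : z ≠ 0 := sub_ne_zero.2 hne
    have hzA : z ∈ A := sub_mem (mul_mem hx hqA) (mul_mem (mul_mem hqA hx) hqA)
    have hqz0 : q * z = 0 := by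
      rw [hz, mul_sub, ← mul_assoc, ← mul_assoc, ← mul_assoc, hq.2.2, sub_self]
    obtain ⟨p, hpp, hpc, hpy⟩ := exists_range_projection h (c := z * star z)
      (mul_mem hzA (star_mem hzA) : z * star z ∈ A) (mul_star_self_nonneg z)
    refine hmax p ⟨hpp, ?_, fun u hu => hpy _ ?_⟩ (hpy q ?_)
    · rintro rfl
      exact hz0 (CStarRing.mul_star_self_eq_zero_iff z |>.1 (by rw [← hpc, zero_mul]))
    · have : e₁ * u * z = 0 := by
        have h1 := hqz _ (mul_mem hu hx)
        have h2 := hqz _ (mul_mem (mul_mem hu hqA) hx)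
        rw [hz, mul_sub]
        simp only [mul_assoc] at h1 h2 ⊢
        rw [h1, h2, sub_zero]
      rw [← mul_assoc, this, zero_mul]
    · rw [← mul_assoc, hqz0, zero_mul]
  obtain ⟨c, hc⟩ := hfac q hqA fun x hx => by
    have h1 := congr(star $(hcut _ (star_mem (S := StarSubalgebra ℂ (Op H)) (s := A) hx)))
    simp only [star_mul, star_star, hq.2.1] at h1
    exact h1.trans ((mul_assoc q x q).symm.trans (hcut x hx).symm)
  by_cases hq0 : q = 0
  · exact hmax e₂ ⟨he₂, he₂0, hzero⟩ (by rw [hq0, zero_mul])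
  · have h1 : (c - 1) • q = 0 := by
      have : c • q = q := by
        nth_rw 2 [← hq.2.2]
        nth_rw 2 [hc]
        rw [smul_mul_assoc, one_mul]
      rw [sub_smul, this, one_smul, sub_self]
    have hc1 : c = 1 := sub_eq_zero.1 ((smul_eq_zero.1 h1).resolve_right hq0)
    rw [hc1, one_smul] at hc
    have := hqz 1 (one_mem A)
    rw [hc, mul_one, mul_one] at this
    exact he₁ this

/-- Polar decomposition, restricted to a spectral subspace, of a nonzero element of a corner. -/
theorem exists_partialIsom (h : IsNormalPLF M φ) {e₁ e₂ a : Op H} (he₂ : star e₂ = e₂)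
    (ha : a ∈ stateCentralizer M φ) (ha0 : a ≠ 0) (ha₁ : e₁ * a = a) (ha₂ : a * e₂ = a) :
    ∃ w ∈ stateCentralizer M φ, w ≠ 0 ∧ IsPartialIsom w ∧ e₁ * w = w ∧ w * e₂ = w := by
  let A := centralizerSubalgebra h.toIsPLF
  have haA : a ∈ A := ha
  set b := star a * a with hb
  have hbA : b ∈ A := mul_mem (star_mem haA) haA
  have hb0 : 0 ≤ b := star_mul_self_nonneg a
  have hbs : IsSelfAdjoint b := hb0.isSelfAdjoint
  have hsp : ∀ t ∈ spectrum ℝ b, 0 ≤ t := fun t ht => spectrum_nonneg_of_nonneg hb0 ht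
  have hbne : b ≠ 0 := fun h0 => ha0 ((CStarRing.star_mul_self_eq_zero_iff a).1 h0)
  set δ := ‖b‖ / 2 with hδ
  have hδ0 : 0 < δ := half_pos (norm_pos_iff.2 hbne)
  have hpos : ∀ t : ℝ, 0 < max t δ := fun t => lt_max_of_lt_right hδ0
  set c := cfc (fun t : ℝ => max (t - δ) 0) b with hc
  have hcA : c ∈ A := cfc_mem_centralizerSubalgebra h.toIsPLF _ hbA
  have hc0 : 0 ≤ c := cfc_nonneg fun t _ => le_max_right _ _
  have hcne : c ≠ 0 := fun h0 => by
    have e := cfc_sub (fun t : ℝ => t) (fun t : ℝ => max (t - δ) 0) b (by fun_prop) (by fun_prop)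
    rw [← hc, h0, cfc_id' ℝ b, sub_zero] at e
    have : ‖b‖ ≤ δ := e ▸ norm_cfc_le hδ0.le fun t ht => by
      have ht0 := hsp t ht
      rw [Real.norm_eq_abs, abs_le]
      rcases le_total (t - δ) 0 with h1 | h1
      · rw [max_eq_right h1]; constructor <;> linarith
      · rw [max_eq_left h1]; constructor <;> linarith
    linarith
  have hcontk : Continuous fun t : ℝ => max (t - δ) 0 / max t δ :=
    Continuous.div (by fun_prop) (by fun_prop) fun t => (hpos t).ne'
  have hck : c = b * cfc (fun t : ℝ => max (t - δ) 0 / max t δ) b := by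
    have e := cfc_mul (fun t : ℝ => t) (fun t : ℝ => max (t - δ) 0 / max t δ) b (by fun_prop)
      hcontk.continuousOn
    rw [cfc_id' ℝ b] at e
    rw [← e, hc]
    refine cfc_congr fun t _ => ?_
    rcases le_total (t - δ) 0 with h1 | h1
    · simp [max_eq_right h1]
    · have : t ≠ 0 := by linarith
      rw [max_eq_left h1, max_eq_left (a := t) (by linarith), mul_div_cancel₀ _ this]
  have hcontg : Continuous fun t : ℝ => 1 / √(max t δ) :=
    Continuous.div (by fun_prop) (by fun_prop) fun t => (Real.sqrt_pos.2 (hpos t)).ne'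
  set g := cfc (fun t : ℝ => 1 / √(max t δ)) b with hg
  have hgA : g ∈ A := cfc_mem_centralizerSubalgebra h.toIsPLF _ hbA
  have hgs : star g = g := (cfc_predicate _ b : IsSelfAdjoint g).star_eq
  have hgc : g * b * g * c = c := by
    have e : g * b = cfc (fun t : ℝ => 1 / √(max t δ) * t) b := by
      rw [cfc_mul _ _ b hcontg.continuousOn (by fun_prop), cfc_id' ℝ b]
    rw [e, hg, ← cfc_mul _ _ b (by fun_prop) hcontg.continuousOn, hc,
      ← cfc_mul _ _ b (by fun_prop) (by fun_prop)]
    refine cfc_congr fun t _ => ?_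
    rcases le_total (t - δ) 0 with h1 | h1
    · simp [max_eq_right h1]
    · have ht : 0 < t := by linarith
      have hs : √t * √t = t := Real.mul_self_sqrt ht.le
      have hs0 : √t ≠ 0 := (Real.sqrt_pos.2 ht).ne'
      have : 1 / √t * t * (1 / √t) = 1 := by
        nth_rw 2 [← hs]
        field_simp
      rw [max_eq_left h1, max_eq_left (a := t) (by linarith), this, one_mul]
  obtain ⟨P, hP, hPc, hPy⟩ := exists_range_projection h hcA hc0
  have hPne : P ≠ 0 := by
    rintro rfl
    exact hcne (by rw [← hPc, zero_mul])
  have hgP : g * b * g * P = P := by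
    have := hPy (g * b * g - 1) (by rw [sub_mul, hgc, one_mul, sub_self])
    rwa [sub_mul, one_mul, sub_eq_zero] at this
  have heP : P * e₂ = P := by
    have hbe : e₂ * b = b := by
      have := congr(star $ha₂)
      rw [star_mul, he₂] at this
      rw [hb, ← mul_assoc, this]
    have := hPy (e₂ - 1) (by rw [hck, sub_mul, ← mul_assoc, hbe, one_mul, sub_self])
    rw [sub_mul, one_mul, sub_eq_zero] at this
    have := congr(star $this)
    rwa [star_mul, he₂, hP.2.1] at this
  have hww : star (a * g * P) * (a * g * P) = P := by
    have : star (a * g * P) * (a * g * P) = P * (g * b * g * P) := by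
      simp only [star_mul, hgs, hP.2.1, hb, mul_assoc]
    rw [this, hgP, hP.2.2]
  have hPA : P ∈ A := hP.1
  refine ⟨a * g * P, (mul_mem (mul_mem haA hgA) hPA : _ ∈ A), fun h0 => hPne ?_, ?_, ?_, ?_⟩
  · rw [← hww, h0, mul_zero]
  · rw [IsPartialIsom, hww, hP.2.2]
  · rw [← mul_assoc, ← mul_assoc, ha₁]
  · rw [mul_assoc, heP]

theorem apply_mul_star_of_intertwining (hψ : IsPLF M ψ) (hφ : IsPLF M φ) {v : Op H} (hv : v ∈ M)
    {l : ℝ} (h : ∀ x ∈ M, ψ (v * x) = (l : ℂ) * φ (x * v)) {x : Op H} (hx : x ∈ M) :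
    ψ (x * star v) = (l : ℂ) * φ (star v * x) := by
  have h1 := hψ.map_star (mul_mem hv (star_mem hx))
  have h2 := hφ.map_star (mul_mem (star_mem hx) hv)
  rw [star_mul, star_star] at h1 h2
  rw [h1, h2, h _ (star_mem hx), map_mul, Complex.conj_ofReal]

/-- The initial projection of an intertwiner belongs to the centralizer. -/
theorem star_mul_self_mem_stateCentralizer (hψ : IsPLF M ψ) (hφ : IsPLF M φ) {v : Op H}
    (hv : v ∈ M) {l : ℝ} (hl : 0 < l) (h : ∀ x ∈ M, ψ (v * x) = (l : ℂ) * φ (x * v)) :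
    star v * v ∈ stateCentralizer M φ := by
  refine ⟨mul_mem (star_mem hv) hv, fun y hy => ?_⟩
  have h1 := apply_mul_star_of_intertwining hψ hφ hv h (mul_mem hv hy)
  rw [mul_assoc, h _ (mul_mem hy (star_mem hv))] at h1
  have := mul_left_cancel₀ (Complex.ofReal_ne_zero.2 hl.ne') h1
  rw [mul_assoc, ← this, mul_assoc]

end Factor

end IntertwiningPreliminaries

/-- Lemma 2.6.  If `φ` is a faithful normal state on `M` whose centralizer
`M_φ` is a factor, then the intertwining relation is transitive through `φ`:
`ψ₁ ∼_M φ` and `ψ₂ ∼_M φ` imply `ψ₁ ∼_M ψ₂`. -/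
theorem intertwined_trans_of_centralizer_factor
    {H : Type} [NormedAddCommGroup H] [InnerProductSpace ℂ H] [CompleteSpace H]
    (M : VonNeumannAlgebra H) (φ : Op H → ℂ)
    (hφ : IsFNState M φ) (hfac : IsFactorSet (stateCentralizer M φ))
    (ψ₁ ψ₂ : Op H → ℂ)
    (hψ₁ : IsNormalPLF M ψ₁) (hψ₁0 : ∃ x ∈ M, ψ₁ x ≠ 0)
    (hψ₂ : IsNormalPLF M ψ₂) (hψ₂0 : ∃ x ∈ M, ψ₂ x ≠ 0)
    (h₁ : Intertwined M ψ₁ φ) (h₂ : Intertwined M ψ₂ φ) :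
    Intertwined M ψ₁ ψ₂ := by
  obtain ⟨v₁, q₁, p₁, l₁, hl₁, hv₁, hi₁, hv₁0, hq₁, -, hqv₁, -, ht₁⟩ := h₁
  obtain ⟨v₂, q₂, p₂, l₂, hl₂, hv₂, hi₂, hv₂0, hq₂, -, hqv₂, -, ht₂⟩ := h₂
  have hN := hφ.1.1
  have he₁ := star_mul_self_mem_stateCentralizer hψ₁.toIsPLF hN.toIsPLF hv₁ hl₁ ht₁
  have he₂ := star_mul_self_mem_stateCentralizer hψ₂.toIsPLF hN.toIsPLF hv₂ hl₂ ht₂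
  have hes : ∀ v : Op H, star (star v * v) = star v * v := fun v => by rw [star_mul, star_star]
  obtain ⟨u, hu, hu0⟩ := exists_mul_mul_ne_zero hN hfac
    (fun h0 => hv₁0 ((CStarRing.star_mul_self_eq_zero_iff v₁).1 h0)) ⟨he₂, hes v₂, hi₂⟩
    (fun h0 => hv₂0 ((CStarRing.star_mul_self_eq_zero_iff v₂).1 h0))
  have hmulA : ∀ {x y : Op H}, x ∈ stateCentralizer M φ → y ∈ stateCentralizer M φ →
      x * y ∈ stateCentralizer M φ := fun hx hy =>
    (centralizerSubalgebra hN.toIsPLF).mul_mem hx hy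
  obtain ⟨w, hw, hw0, hwi, hw₁, hw₂⟩ := exists_partialIsom hN
    (e₁ := star v₁ * v₁) (hes v₂) (hmulA (hmulA he₁ hu) he₂) hu0
    (by rw [mul_assoc _ u, ← mul_assoc (star v₁ * v₁), hi₁]) (by rw [mul_assoc, hi₂])
  have hw₂' : star v₂ * v₂ * star w = star w := by
    have := congr(star $hw₂)
    rwa [star_mul, hes] at this
  have hvv : star (v₁ * w * star v₂) * (v₁ * w * star v₂) = v₂ * (star w * w) * star v₂ := by
    calc _ = v₂ * star w * (star v₁ * v₁ * w) * star v₂ := by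
          simp only [star_mul, star_star, mul_assoc]
      _ = _ := by rw [hw₁, mul_assoc v₂]
  refine ⟨v₁ * w * star v₂, q₁, q₂, l₁ / l₂, div_pos hl₁ hl₂,
    mul_mem (mul_mem hv₁ hw.1) (star_mem hv₂), ?_, fun h0 => hw0 ?_, hq₁, hq₂, ?_, ?_,
    fun x hx => ?_⟩
  · rw [IsPartialIsom, hvv]
    calc _ = v₂ * (star w * (w * (star v₂ * v₂)) * (star w * w)) * star v₂ := by
          simp only [mul_assoc]
      _ = _ := by rw [hw₂, hwi]
  · calc w = star v₁ * v₁ * w * (star v₂ * v₂) := by rw [hw₁, hw₂]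
      _ = star v₁ * (v₁ * w * star v₂) * v₂ := by simp only [mul_assoc]
      _ = 0 := by rw [h0, mul_zero, zero_mul]
  · rw [← mul_assoc, ← mul_assoc, hqv₁]
  · have := congr(star $hqv₂)
    rw [star_mul, hq₂.1.2.1] at this
    rw [mul_assoc, this]
  · have hl₂' : (l₂ : ℂ) ≠ 0 := Complex.ofReal_ne_zero.2 hl₂.ne'
    have h1 := ht₁ _ (mul_mem (mul_mem hw.1 (star_mem hv₂)) hx)
    have h2 := hw.2 _ (mul_mem (mul_mem (star_mem hv₂) hx) hv₁)
    have h3 := apply_mul_star_of_intertwining hψ₂.toIsPLF hN.toIsPLF hv₂ ht₂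
      (mul_mem (mul_mem hx hv₁) hw.1)
    simp only [mul_assoc] at h1 h2 h3 ⊢
    rw [h1, h2, h3]
    push_cast
    field_simp

end HSC
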